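/- Let λ = (λ_1, …, λ_n) be a partition that is not saturated. Then the Ferrers ideal I_λ is not sequentially Cohen-Macaulay. -/

import Mathlib

open CategoryTheory CategoryTheory.Limits MvPolynomial

noncomputable section

namespace SkewTab

/-! ### Partitions and skew shapes (0-indexed) -/

/-- `lam` is a partition with exactly `n` positive parts (0-indexed),
extended by `0` beyond index `n - 1`. -/
def IsPartitionFn (n : ℕ) (lam : ℕ → ℕ) : Prop :=
  0 < n ∧ Antitone lam ∧ (∀ i, i < n → 0 < lam i) ∧ ∀ i, n ≤ i → lam i = 0

/-- `λ/μ` is a skew shape with `n` rows (0-indexed): `λ_i > μ_i ≥ 0` and `μ_n = 0`. -/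
def IsSkewShape (n : ℕ) (lam mu : ℕ → ℕ) : Prop :=
  0 < n ∧ Antitone lam ∧ Antitone mu ∧ (∀ i, i < n → mu i < lam i) ∧
    (∀ i, n ≤ i → lam i = 0) ∧ mu (n - 1) = 0

/-- The conjugate partition: `conj lam j = #{i : lam i > j}` (0-indexed). -/
def conj (lam : ℕ → ℕ) (j : ℕ) : ℕ := Nat.card {i | j < lam i}

/-- The set of boxes of the skew diagram `λ/μ` (0-indexed `(row, column)` pairs). -/
def skewDiagram (lam mu : ℕ → ℕ) : Set (ℕ × ℕ) :=
  {p | mu p.1 ≤ p.2 ∧ p.2 < lam p.1}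

/-- The set of boxes of the Ferrers diagram of a partition. -/
def ferrers (nu : ℕ → ℕ) : Set (ℕ × ℕ) := {p | p.2 < nu p.1}

/-- The block of the Ferrers diagram of `nu` containing the box `p`:  blocks are the
rectangular regions cut out by the horizontal lines at the values of the conjugate
partition and the vertical lines at the values of the partition. -/
def blockOf (nu : ℕ → ℕ) (p : ℕ × ℕ) : Set (ℕ × ℕ) :=
  {q | q.2 < nu q.1 ∧ nu q.1 = nu p.1 ∧ conj nu q.2 = conj nu p.2}

/-- A box `(i,j)` of the diagram of `nu` lies in a *corner block* iff its block has no
block to its right nor below it. -/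
def InCornerBlock (nu : ℕ → ℕ) (i j : ℕ) : Prop :=
  j < nu i ∧ conj nu (nu i - 1) = conj nu j ∧ nu (conj nu j - 1) = nu i

/-- A partition is unmixed iff all its corner blocks are square
(height of the block = width of the block). -/
def IsUnmixedPartition (nu : ℕ → ℕ) : Prop :=
  (∃ n, IsPartitionFn n nu) ∧
    ∀ i j, InCornerBlock nu i j →
      conj nu (nu i - 1) - conj nu (nu i) = nu (conj nu j - 1) - nu (conj nu j)

/-- A partition all of whose corner blocks are single boxes (1 × 1):
the condition defining prime Cohen-Macaulay shapes. -/
def IsCMPartition (nu : ℕ → ℕ) : Prop :=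
  (∃ n, IsPartitionFn n nu) ∧
    ∀ i j, InCornerBlock nu i j →
      conj nu (nu i - 1) - conj nu (nu i) = 1 ∧ nu (conj nu j - 1) - nu (conj nu j) = 1

/-- A copy of (the diagram of) a partition `nu` placed in the plane.  If `upper = true`
it is placed rotated by 180° and anchored at the bottom-right position `(row, col)`
(an upper triangular shape, hugging the top-right); if `upper = false` it is placed as is,
translated by `(row, col)` (a lower triangular shape, hugging the bottom-left). -/
structure PlacedShape where
  nu : ℕ → ℕ
  row : ℕ
  col : ℕ
  upper : Bool

/-- The embedding of the abstract diagram of `B.nu` into the plane. -/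
def PlacedShape.emb (B : PlacedShape) : ℕ × ℕ → ℕ × ℕ := fun p =>
  if B.upper then (B.row - p.1, B.col - p.2) else (B.row + p.1, B.col + p.2)

/-- The set of boxes of a placed shape. -/
def PlacedShape.boxes (B : PlacedShape) : Set (ℕ × ℕ) := B.emb '' ferrers B.nu

/-- For an upper triangular placed shape the anchor must leave room for the whole
(rotated) diagram. -/
def PlacedShape.Valid (B : PlacedShape) : Prop :=
  B.upper = true → conj B.nu 0 ≤ B.row + 1 ∧ B.nu 0 ≤ B.col + 1

/-- The two extremal blocks (top-right and bottom-left corner blocks) of a placed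
shape, as subsets of the plane. -/
def PlacedShape.extremalBlocks (B : PlacedShape) : Set (Set (ℕ × ℕ)) :=
  {B.emb '' blockOf B.nu (0, B.nu 0 - 1), B.emb '' blockOf B.nu (conj B.nu 0 - 1, 0)}

/-- `D` decomposes as a union of prime shapes `B 0, …, B (t-1)` (each a placed copy of a
partition satisfying `P`), consecutive shapes being of alternating (upper/lower) type and
intersecting exactly in a common extremal block. -/
def IsPrimeDecomposition (P : (ℕ → ℕ) → Prop) (D : Set (ℕ × ℕ)) (t : ℕ)
    (B : ℕ → PlacedShape) : Prop :=
  0 < t ∧ (∀ k, k < t → P (B k).nu ∧ (B k).Valid) ∧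
    (⋃ k ∈ Set.Iio t, (B k).boxes) = D ∧
    (∀ k, k + 1 < t → (B k).upper ≠ (B (k + 1)).upper) ∧
    ∀ k, k + 1 < t →
      (B k).boxes ∩ (B (k + 1)).boxes ∈ (B k).extremalBlocks ∧
      (B k).boxes ∩ (B (k + 1)).boxes ∈ (B (k + 1)).extremalBlocks

/-- The filling `w` is weakly increasing along both rows and columns on the boxes of `S`. -/
def WeaklyIncreasingOn (w : ℕ → ℕ → ℕ) (S : Set (ℕ × ℕ)) : Prop :=
  (∀ i j, (i, j) ∈ S → (i, j + 1) ∈ S → w i j ≤ w i (j + 1)) ∧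
    ∀ i j, (i, j) ∈ S → (i + 1, j) ∈ S → w i j ≤ w (i + 1) j

/-- The filling `w` is weakly decreasing along both rows and columns on the boxes of `S`. -/
def WeaklyDecreasingOn (w : ℕ → ℕ → ℕ) (S : Set (ℕ × ℕ)) : Prop :=
  (∀ i j, (i, j) ∈ S → (i, j + 1) ∈ S → w i (j + 1) ≤ w i j) ∧
    ∀ i j, (i, j) ∈ S → (i + 1, j) ∈ S → w (i + 1) j ≤ w i j

/-! ### Ideals and graphs attached to skew shapes -/

/-- The skew Ferrers ideal `I_{λ/μ}` in `k[x_1,…,x_n,y_1,…,y_m]`, `m = λ_1`. -/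
def skewIdeal (k : Type) [Field k] (n : ℕ) (lam mu : ℕ → ℕ) :
    Ideal (MvPolynomial (Fin n ⊕ Fin (lam 0)) k) :=
  Ideal.span {q | ∃ (i : Fin n) (j : Fin (lam 0)),
    mu (i : ℕ) ≤ (j : ℕ) ∧ (j : ℕ) < lam (i : ℕ) ∧ q = X (Sum.inl i) * X (Sum.inr j)}

/-- The skew tableau ideal `I(Y)` of the filling `w` of the skew shape `λ/μ`. -/
def tableauIdeal (k : Type) [Field k] (n : ℕ) (lam mu : ℕ → ℕ) (w : ℕ → ℕ → ℕ) :
    Ideal (MvPolynomial (Fin n ⊕ Fin (lam 0)) k) :=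
  Ideal.span {q | ∃ (i : Fin n) (j : Fin (lam 0)),
    mu (i : ℕ) ≤ (j : ℕ) ∧ (j : ℕ) < lam (i : ℕ) ∧
      q = (X (Sum.inl i) * X (Sum.inr j)) ^ w (i : ℕ) (j : ℕ)}

/-- The skew tableau ideal of the skew tableau obtained from `Y` by keeping only the rows
in `Rs` and the columns in `Cs`. -/
def tableauIdealRC (k : Type) [Field k] (n m : ℕ) (lam mu : ℕ → ℕ) (w : ℕ → ℕ → ℕ)
    (Rs : Set (Fin n)) (Cs : Set (Fin m)) : Ideal (MvPolynomial (↥Rs ⊕ ↥Cs) k) :=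
  Ideal.span {q | ∃ (i : ↥Rs) (j : ↥Cs),
    mu (i.1 : ℕ) ≤ (j.1 : ℕ) ∧ (j.1 : ℕ) < lam (i.1 : ℕ) ∧
      q = (X (Sum.inl i) * X (Sum.inr j)) ^ w (i.1 : ℕ) (j.1 : ℕ)}

/-- The skew Ferrers graph `G_{λ/μ}`, a bipartite graph on `{x_1,…,x_n} ⊔ {y_1,…,y_m}`. -/
def skewGraph (n : ℕ) (lam mu : ℕ → ℕ) : SimpleGraph (Fin n ⊕ Fin (lam 0)) :=
  SimpleGraph.fromRel fun a b => ∃ (i : Fin n) (j : Fin (lam 0)),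
    mu (i : ℕ) ≤ (j : ℕ) ∧ (j : ℕ) < lam (i : ℕ) ∧ a = Sum.inl i ∧ b = Sum.inr j

/-- The edge ideal of a simple graph. -/
def edgeIdeal (k : Type) [Field k] {V : Type} (G : SimpleGraph V) :
    Ideal (MvPolynomial V k) :=
  Ideal.span {q | ∃ u v, G.Adj u v ∧ q = X u * X v}

/-- The edge ideal of an edge-weighted simple graph. -/
def edgeIdealW (k : Type) [Field k] {V : Type} (G : SimpleGraph V) (w : V → V → ℕ) :
    Ideal (MvPolynomial V k) :=
  Ideal.span {q | ∃ u v, G.Adj u v ∧ q = (X u * X v) ^ w u v}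

/-! ### Homological notions -/

/-- The homogeneous maximal ideal of a polynomial ring. -/
def maxIdeal (k : Type) [Field k] (σ : Type) : Ideal (MvPolynomial σ k) :=
  Ideal.span (Set.range (X : σ → MvPolynomial σ k))

/-- The `i`-th local cohomology of the `R`-module `M` supported at the ideal `J`. -/
def localCoh {R : Type} [CommRing R] (J : Ideal R) (i : ℕ) (M : Type) [AddCommGroup M]
    [Module R M] : ModuleCat R :=
  (localCohomology J i).obj (ModuleCat.of R M)

/-- The Krull dimension of a module, `dim (R / ann M)`. -/
def moduleDim (R : Type) [CommRing R] (M : Type) [AddCommGroup M] [Module R M] :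
    WithBot ℕ∞ :=
  ringKrullDim (R ⧸ Module.annihilator R M)

/-- A module `M` is Cohen-Macaulay (w.r.t. the maximal ideal `J`) if
`H^i_J(M) = 0` for all `i < dim M`. -/
def IsCMModule {R : Type} [CommRing R] (J : Ideal R) (M : Type) [AddCommGroup M]
    [Module R M] : Prop :=
  ∀ i : ℕ, (i : WithBot ℕ∞) < moduleDim R M → IsZero (localCoh J i M)

/-- An ideal `I` is Cohen-Macaulay if `H^i_J(R/I) = 0` for all `i < dim R/I`
(`J` the maximal ideal). -/
def IsCMIdeal {R : Type} [CommRing R] (J I : Ideal R) : Prop :=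
  ∀ i : ℕ, (i : WithBot ℕ∞) < ringKrullDim (R ⧸ I) → IsZero (localCoh J i (R ⧸ I))

/-- An ideal `I` is generalized Cohen-Macaulay if `H^i_J(R/I)` has finite length for
all `i < dim R/I`. -/
def IsGCMIdeal {R : Type} [CommRing R] (J I : Ideal R) : Prop :=
  ∀ i : ℕ, (i : WithBot ℕ∞) < ringKrullDim (R ⧸ I) → IsFiniteLength R (localCoh J i (R ⧸ I))

/-- The canonical map `Ext^i(R/J, M) → H^i_J(M)`, i.e. the structure map of the colimit
defining local cohomology, at the first power of `J`. -/
def extToLocalCoh {R : Type} [CommRing R] (J : Ideal R) (i : ℕ) (M : ModuleCat R) :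
    ((localCohomology.diagram (localCohomology.idealPowersDiagram J) i).obj
        (Opposite.op (Opposite.op (1 : ℕ)))).obj M ⟶ (localCohomology J i).obj M :=
  have := localCohomology.hasColimitDiagram (localCohomology.idealPowersDiagram J) i
  (colimit.ι (localCohomology.diagram (localCohomology.idealPowersDiagram J) i)
    (Opposite.op (Opposite.op (1 : ℕ)))).app M

/-- An ideal `I` is Buchsbaum if the canonical map `Ext^i(R/J, R/I) → H^i_J(R/I)` is
surjective for all `i < dim R/I` (`J` the maximal ideal). -/
def IsBuchsbaumIdeal {R : Type} [CommRing R] (J I : Ideal R) : Prop :=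
  ∀ i : ℕ, (i : WithBot ℕ∞) < ringKrullDim (R ⧸ I) →
    Function.Surjective (extToLocalCoh J i (ModuleCat.of R (R ⧸ I)))

/-- An ideal `I` is unmixed if `dim R/P = dim R/I` for all associated primes `P` of `R/I`. -/
def IsUnmixedIdeal {R : Type} [CommRing R] (I : Ideal R) : Prop :=
  ∀ P ∈ associatedPrimes R (R ⧸ I), ringKrullDim (R ⧸ P) = ringKrullDim (R ⧸ I)

/-- A submodule of `S/J` (`S` a polynomial ring) is graded if it is the image of a
homogeneous ideal of `S`. -/
def IsGradedSubmodule (k σ : Type) [Field k] (J : Ideal (MvPolynomial σ k))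
    (N : Submodule (MvPolynomial σ k) (MvPolynomial σ k ⧸ J)) : Prop :=
  letI := MvPolynomial.gradedAlgebra (σ := σ) (R := k)
  ∃ K : Ideal (MvPolynomial σ k), Ideal.IsHomogeneous (homogeneousSubmodule σ k) K ∧
    ∀ x, x ∈ N ↔ x ∈ K.map (Ideal.Quotient.mk J)

/-- A (homogeneous) ideal `J` of a polynomial ring `S` is sequentially Cohen-Macaulay if
`S/J` admits a filtration `0 = M_0 ⊂ M_1 ⊂ ⋯ ⊂ M_r = S/J` by graded submodules such that
every quotient `M_{i+1}/M_i` is Cohen-Macaulay and the dimensions of the quotients are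
strictly increasing. -/
def IsSCMIdeal (k σ : Type) [Field k] (J : Ideal (MvPolynomial σ k)) : Prop :=
  ∃ (r : ℕ) (M : ℕ → Submodule (MvPolynomial σ k) (MvPolynomial σ k ⧸ J)),
    M 0 = ⊥ ∧ M r = ⊤ ∧ (∀ i, i < r → M i < M (i + 1)) ∧
    (∀ i, i ≤ r → IsGradedSubmodule k σ J (M i)) ∧
    (∀ i, i < r → IsCMModule (maxIdeal k σ)
      (↥(M (i + 1)) ⧸ Submodule.comap (M (i + 1)).subtype (M i))) ∧
    ∀ i, i + 2 ≤ r →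
      moduleDim (MvPolynomial σ k)
          (↥(M (i + 1)) ⧸ Submodule.comap (M (i + 1)).subtype (M i)) <
        moduleDim (MvPolynomial σ k)
          (↥(M (i + 2)) ⧸ Submodule.comap (M (i + 2)).subtype (M (i + 1)))

/-- A graph is sequentially Cohen-Macaulay if its edge ideal is. -/
def IsSCMGraph (k : Type) [Field k] {V : Type} (G : SimpleGraph V) : Prop :=
  IsSCMIdeal k V (edgeIdeal k G)

/-! ### Monomial ideals -/

/-- A monomial of a polynomial ring. -/
def IsMonomial {k σ : Type} [Field k] (u : MvPolynomial σ k) : Prop :=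
  ∃ d : σ →₀ ℕ, u = monomial d 1

/-- A monomial ideal of a polynomial ring. -/
def IsMonomialIdeal {k σ : Type} [Field k] (I : Ideal (MvPolynomial σ k)) : Prop :=
  ∃ T : Set (σ →₀ ℕ), I = Ideal.span ((fun d => (monomial d (1 : k) : MvPolynomial σ k)) '' T)

/-! ### Saturated partitions -/

/-- A partition is saturated if it is either strictly decreasing, or
`{λ_i, λ_i - 1, …, 1} ⊆ {λ_1, …, λ_n}` where `i` is the smallest index with
`λ_i = λ_{i+1}` (0-indexed here). -/
def IsSaturated (n : ℕ) (lam : ℕ → ℕ) : Prop :=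
  StrictAntiOn lam (Set.Iio n) ∨
    ∃ i, i + 1 < n ∧ lam i = lam (i + 1) ∧ (∀ j, j < i → lam j ≠ lam (j + 1)) ∧
      ∀ v, 0 < v → v ≤ lam i → ∃ a, a < n ∧ lam a = v

/-! ### Vertex decomposability -/

/-- A set `T` of vertices is independent in `G`. -/
def IsIndepSet {V : Type} (G : SimpleGraph V) (T : Finset V) : Prop :=
  ∀ u ∈ T, ∀ v ∈ T, ¬G.Adj u v

open Classical in
/-- The induced subgraph of `G` on a finite vertex set `A` is vertex decomposable:
either it has no edges, or it has a shredding vertex `v`, i.e. a vertex such that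
`G \ v` and `G \ N[v]` are vertex decomposable and no independent set of `G \ N[v]`
is a maximal independent set of `G \ v`. -/
def IsVertexDecomposable {V : Type} (G : SimpleGraph V) : Finset V → Prop := fun A =>
  (∀ u ∈ A, ∀ v ∈ A, ¬G.Adj u v) ∨
    ∃ v, ∃ _ : v ∈ A,
      IsVertexDecomposable G (A.erase v) ∧
      IsVertexDecomposable G (A.filter fun u => u ≠ v ∧ ¬G.Adj v u) ∧
      ∀ T ⊆ A.filter fun u => u ≠ v ∧ ¬G.Adj v u, IsIndepSet G T →
        ¬(T ⊆ A.erase v ∧ IsIndepSet G T ∧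
            ∀ u ∈ A.erase v, u ∉ T → ∃ t ∈ T, G.Adj u t)
termination_by A => A.card
decreasing_by
  · exact Finset.card_erase_lt_of_mem ‹_›
  · exact Finset.card_lt_card (Finset.filter_ssubset.mpr ⟨v, ‹_›, by simp⟩)

section DerivedClass

universe v u v' u'

variable {C : Type u} [Category.{v} C] [Abelian C] [EnoughProjectives C]
  {D : Type u'} [Category.{v'} D] [Abelian D]

/-- The morphism out of the homology of a chain complex given by a cocycle. -/
def homologyDesc (K : ChainComplex D ℕ) {n : ℕ} {J : D} (κ : K.X n ⟶ J)
    (hκ : K.d (n + 1) n ≫ κ = 0) : K.homology n ⟶ J :=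
  K.homologyι n ≫ K.descOpcycles κ (n + 1) (by simp) hκ

lemma map_homologyDesc {K K' : ChainComplex D ℕ} (φ : K' ⟶ K) {n : ℕ} {J : D} (κ : K.X n ⟶ J)
    (hκ : K.d (n + 1) n ≫ κ = 0) :
    HomologicalComplex.homologyMap φ n ≫ homologyDesc K κ hκ =
      homologyDesc K' (φ.f n ≫ κ) (by rw [← φ.comm_assoc, hκ, comp_zero]) := by
  simp [homologyDesc]

lemma exists_of_homologyDesc_eq_zero {K : ChainComplex D ℕ} {p : ℕ} {J : D} [Injective J]
    {κ : K.X (p + 1) ⟶ J} {hκ : K.d (p + 1 + 1) (p + 1) ≫ κ = 0}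
    (h : homologyDesc K κ hκ = 0) : ∃ κ' : K.X p ⟶ J, K.d (p + 1) p ≫ κ' = κ := by
  have ex : (ShortComplex.mk _ _ (K.homologyι_comp_fromOpcycles (p + 1) p)).Exact :=
    ShortComplex.exact_of_f_is_kernel _ (K.homologyIsKernel (p + 1) p (by simp))
  refine ⟨ex.descToInjective _ h, ?_⟩
  have h2 := ex.comp_descToInjective _ h
  dsimp only at h2
  rw [← K.p_fromOpcycles, Category.assoc, h2, K.p_descOpcycles]

lemma eq_zero_of_homologyDesc_eq_zero {K : ChainComplex D ℕ} {J : D}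
    {κ : K.X 0 ⟶ J} {hκ : K.d (0 + 1) 0 ≫ κ = 0} (h : homologyDesc K κ hκ = 0) : κ = 0 := by
  have : IsIso (K.homologyι 0) := inferInstance
  have h2 : K.descOpcycles κ (0 + 1) (by simp) hκ = 0 := by
    rw [← cancel_epi (K.homologyι 0), comp_zero]
    exact h
  rw [← K.p_descOpcycles κ (0 + 1) (by simp) hκ, h2]
  exact comp_zero

variable (F : C ⥤ D) [F.Additive]

/-- A left derived functor, computed as the homology of the image of a projective resolution. -/
def leftDerivedIsoHomology {X : C} (P : ProjectiveResolution X) (n : ℕ) :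
    (F.leftDerived n).obj X ≅ ((F.mapHomologicalComplex _).obj P.complex).homology n :=
  P.isoLeftDerivedObj F n

lemma leftDerived_map_comp_isoHomology_hom {X X' : C} {P : ProjectiveResolution X}
    {P' : ProjectiveResolution X'} {g : X' ⟶ X} (φ : ProjectiveResolution.Hom P' P g) (n : ℕ) :
    (F.leftDerived n).map g ≫ (leftDerivedIsoHomology F P n).hom =
      (leftDerivedIsoHomology F P' n).hom ≫
        HomologicalComplex.homologyMap ((F.mapHomologicalComplex _).map φ.hom) n :=
  ProjectiveResolution.isoLeftDerivedObj_hom_naturality g P' P φ.hom (by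
    rw [φ.hom_f_zero_comp_π_f_zero, ChainComplex.single₀_map_f_zero]
    rfl) F n

/-- The morphism out of a left derived functor given by a cocycle on a projective resolution. -/
def derivedClass {X : C} (P : ProjectiveResolution X) {n : ℕ} {J : D}
    (κ : ((F.mapHomologicalComplex _).obj P.complex).X n ⟶ J)
    (hκ : ((F.mapHomologicalComplex _).obj P.complex).d (n + 1) n ≫ κ = 0) :
    (F.leftDerived n).obj X ⟶ J :=
  (leftDerivedIsoHomology F P n).hom ≫ homologyDesc _ κ hκ

variable {F}

lemma homologyDesc_eq_zero {X : C} {P : ProjectiveResolution X} {n : ℕ} {J : D}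
    {κ : ((F.mapHomologicalComplex _).obj P.complex).X n ⟶ J}
    {hκ : ((F.mapHomologicalComplex _).obj P.complex).d (n + 1) n ≫ κ = 0}
    (h : derivedClass F P κ hκ = 0) : homologyDesc _ κ hκ = 0 := by
  rwa [← cancel_epi (leftDerivedIsoHomology F P n).hom, comp_zero]

lemma map_derivedClass {X X' : C} {P : ProjectiveResolution X} {P' : ProjectiveResolution X'}
    {g : X' ⟶ X} (φ : ProjectiveResolution.Hom P' P g) {n : ℕ} {J : D}
    (κ : ((F.mapHomologicalComplex _).obj P.complex).X n ⟶ J)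
    (hκ : ((F.mapHomologicalComplex _).obj P.complex).d (n + 1) n ≫ κ = 0) :
    (F.leftDerived n).map g ≫ derivedClass F P κ hκ =
      derivedClass F P' (((F.mapHomologicalComplex _).map φ.hom).f n ≫ κ)
        (by rw [← HomologicalComplex.Hom.comm_assoc, hκ, comp_zero]) := by
  unfold derivedClass
  rw [← map_homologyDesc, reassoc_of% leftDerived_map_comp_isoHomology_hom F φ n]

end DerivedClass

section Bridge

variable {R : Type} [CommRing R]

/-- The element of a `Hom` module, seen as a map out of the base ring in the opposite category. -/
def homElement {M N : ModuleCat.{0} R} (f : M ⟶ N) :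
    ((linearYoneda R (ModuleCat.{0} R)).obj N).rightOp.obj M ⟶ Opposite.op (ModuleCat.of R R) :=
  (ModuleCat.ofHom (LinearMap.toSpanSingleton R (M ⟶ N) f)).op

lemma homElement_unop_one {M N : ModuleCat.{0} R} (f : M ⟶ N) :
    (homElement f).unop.hom (1 : R) = f :=
  one_smul R f

lemma eq_homElement {M N : ModuleCat.{0} R}
    {κ : ((linearYoneda R (ModuleCat.{0} R)).obj N).rightOp.obj M ⟶
      Opposite.op (ModuleCat.of R R)} {f : M ⟶ N} (h : κ.unop.hom (1 : R) = f) :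
    κ = homElement f := by
  apply Quiver.Hom.unop_inj
  ext
  exact h.trans (homElement_unop_one f).symm

lemma homElement_injective {M N : ModuleCat.{0} R} {f g : M ⟶ N}
    (h : homElement f = homElement g) : f = g := by
  rw [← homElement_unop_one f, h, homElement_unop_one]

lemma map_comp_homElement {M M' N : ModuleCat.{0} R} (g : M' ⟶ M) (f : M ⟶ N) :
    ((linearYoneda R (ModuleCat.{0} R)).obj N).rightOp.map g ≫ homElement f =
      homElement (g ≫ f) :=
  eq_homElement (congrArg (g ≫ ·) (homElement_unop_one f))

lemma homElement_zero {M N : ModuleCat.{0} R} : homElement (0 : M ⟶ N) = 0 :=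
  (eq_homElement (κ := 0) rfl).symm

/-- The map to `Ext` given by a cocycle on a projective resolution. -/
def extClassMap {X N : ModuleCat.{0} R} (P : ProjectiveResolution X) {n : ℕ}
    (f : P.complex.X n ⟶ N) (hf : P.complex.d (n + 1) n ≫ f = 0) :
    (((linearYoneda R (ModuleCat.{0} R)).obj N).rightOp.leftDerived n).obj X ⟶
      Opposite.op (ModuleCat.of R R) :=
  derivedClass _ P (homElement f)
    ((map_comp_homElement (P.complex.d (n + 1) n) f).trans (by rw [hf]; exact homElement_zero))

lemma map_extClassMap {X X' N : ModuleCat.{0} R} {P : ProjectiveResolution X}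
    {P' : ProjectiveResolution X'} {g : X' ⟶ X} (φ : ProjectiveResolution.Hom P' P g) {n : ℕ}
    (f : P.complex.X n ⟶ N) (hf : P.complex.d (n + 1) n ≫ f = 0) :
    (((linearYoneda R (ModuleCat.{0} R)).obj N).rightOp.leftDerived n).map g ≫ extClassMap P f hf =
      extClassMap P' (φ.hom.f n ≫ f) (by rw [← φ.hom.comm_assoc, hf]; exact comp_zero) := by
  refine (map_derivedClass φ _ _).trans ?_
  unfold extClassMap
  congr 1

lemma extMk_eq_zero_of_extClassMap_eq_zero {X N : ModuleCat.{0} R} {P : ProjectiveResolution X}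
    {n : ℕ} {f : P.complex.X n ⟶ N} {hf : P.complex.d (n + 1) n ≫ f = 0}
    (h : extClassMap P f hf = 0) : P.extMk f (n + 1) rfl hf = 0 := by
  have h1 := homologyDesc_eq_zero h
  obtain - | p := n
  · have h2 : f = 0 := homElement_injective
      ((eq_zero_of_homologyDesc_eq_zero h1).trans homElement_zero.symm)
    subst h2
    simp
  · obtain ⟨κ, hκ⟩ := exists_of_homologyDesc_eq_zero h1
    rw [P.extMk_eq_zero_iff _ _ _ _ p rfl]
    obtain ⟨g, hg⟩ : ∃ g : P.complex.X p ⟶ N, κ = homElement g :=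
      ⟨κ.unop.hom (1 : R), eq_homElement rfl⟩
    refine ⟨g, homElement_injective ?_⟩
    rw [← map_comp_homElement, ← hg]
    exact hκ

/-- If local cohomology vanishes, every `Ext` class out of `R ⧸ J ^ t` dies on `R ⧸ J ^ t'` for
some `t' ≥ t`. -/
lemma exists_mk₀_comp_eq_zero {J : Ideal R} {i : ℕ} {N : ModuleCat.{0} R}
    (h : IsZero ((localCohomology J i).obj N)) (t : ℕ)
    (α : Abelian.Ext (ModuleCat.of R (R ⧸ J ^ t)) N i) :
    ∃ (t' : ℕ) (ht : t ≤ t'), (Abelian.Ext.mk₀ (ModuleCat.ofHom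
      (Submodule.mapQ (J ^ t') (J ^ t) LinearMap.id (Ideal.pow_le_pow_right ht)))).comp α
        (zero_add i) = 0 := by
  let P := fun t : ℕ => ProjectiveResolution.of (ModuleCat.of R (R ⧸ J ^ t))
  obtain ⟨f, hf, rfl⟩ := (P t).extMk_surjective α (i + 1) rfl
  let G := localCohomology.diagram (localCohomology.idealPowersDiagram J) i
  let e := (evaluation (ModuleCat.{0} R) (ModuleCat.{0} R)).obj N
  have hG : IsColimit (e.mapCocone (colimit.cocone G)) :=
    isColimitOfPreserves _ (colimit.isColimit G)
  let c : (G ⋙ e).obj (Opposite.op (Opposite.op t)) := (extClassMap (P t) f hf).unop.hom (1 : R)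
  have h0 : (e.mapCocone (colimit.cocone G)).ι.app _ c =
      (e.mapCocone (colimit.cocone G)).ι.app (Opposite.op (Opposite.op t)) 0 :=
    @Subsingleton.elim _ (ModuleCat.subsingleton_of_isZero h) _ _
  obtain ⟨⟨⟨t'⟩⟩, u, v, huv⟩ := Concrete.isColimit_exists_of_rep_eq.{0} (G ⋙ e) hG c 0 h0
  refine ⟨t', u.unop.unop.down.down, ?_⟩
  let g : ModuleCat.of R (R ⧸ J ^ t') ⟶ ModuleCat.of R (R ⧸ J ^ t) := ModuleCat.ofHom
      (Submodule.mapQ (J ^ t') (J ^ t) LinearMap.id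
        (Ideal.pow_le_pow_right u.unop.unop.down.down))
  let φ : ProjectiveResolution.Hom (P t') (P t) g :=
    ⟨ProjectiveResolution.lift g (P t') (P t),
      ProjectiveResolution.lift_commutes_zero g (P t') (P t)⟩
  rw [map_zero] at huv
  rw [ProjectiveResolution.mk₀_comp_extMk _ _ _ _ φ]
  apply extMk_eq_zero_of_extClassMap_eq_zero
  rw [← map_extClassMap φ]
  apply Quiver.Hom.unop_inj
  ext
  exact huv

end Bridge

section ExtVanishing

variable {R : Type} [CommRing R]

lemma subsingleton_ext_of_exact {N : ModuleCat.{0} R} {j : ℕ}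
    {A B C : Type} [AddCommGroup A] [Module R A] [AddCommGroup B] [Module R B]
    [AddCommGroup C] [Module R C] (f : A →ₗ[R] B) (g : B →ₗ[R] C)
    (hf : Function.Injective f) (hg : Function.Surjective g) (hfg : Function.Exact f g)
    (hA : Subsingleton (Abelian.Ext (ModuleCat.of R A) N j))
    (hC : Subsingleton (Abelian.Ext (ModuleCat.of R C) N j)) :
    Subsingleton (Abelian.Ext (ModuleCat.of R B) N j) := by
  let T : ShortComplex (ModuleCat.{0} R) :=
    ShortComplex.mk (ModuleCat.ofHom f) (ModuleCat.ofHom g)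
      (ModuleCat.hom_ext (LinearMap.ext fun x => (hfg (f x)).mpr ⟨x, rfl⟩))
  have hT : T.ShortExact := ModuleCat.shortComplex_shortExact T hfg hf hg
  refine subsingleton_of_forall_eq 0 fun x => ?_
  obtain ⟨y, rfl⟩ := Abelian.Ext.contravariant_sequence_exact₂ hT N x
    (@Subsingleton.elim _ hA _ _)
  rw [@Subsingleton.elim _ hC y 0, Abelian.Ext.comp_zero]

lemma subsingleton_ext_of_subsingleton {N : ModuleCat.{0} R} {j : ℕ}
    {A : Type} [AddCommGroup A] [Module R A] [Subsingleton A] :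
    Subsingleton (Abelian.Ext (ModuleCat.of R A) N j) := by
  refine subsingleton_of_forall_eq 0 fun x => ?_
  rw [← Abelian.Ext.mk₀_id_comp x, (ModuleCat.isZero_of_subsingleton (ModuleCat.of R A)).eq_of_src
    (𝟙 _) 0, Abelian.Ext.mk₀_zero, Abelian.Ext.zero_comp]

lemma subsingleton_ext_of_linearEquiv {N : ModuleCat.{0} R} {j : ℕ}
    {A B : Type} [AddCommGroup A] [Module R A] [AddCommGroup B] [Module R B] (e : A ≃ₗ[R] B)
    (hA : Subsingleton (Abelian.Ext (ModuleCat.of R A) N j)) :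
    Subsingleton (Abelian.Ext (ModuleCat.of R B) N j) :=
  subsingleton_ext_of_exact (C := PUnit) e.toLinearMap 0 e.injective
    (Function.surjective_to_subsingleton _)
    ((e.toLinearMap.exact_zero_iff_surjective _).2 e.surjective) hA
    subsingleton_ext_of_subsingleton

lemma subsingleton_ext_of_pow_smul_eq_zero [IsNoetherianRing R] {m : Ideal R} [m.IsMaximal]
    {N : ModuleCat.{0} R} {i : ℕ}
    (h : ∀ j < i, Subsingleton (Abelian.Ext (ModuleCat.of R (R ⧸ m)) N j)) (s : ℕ)
    {T : Type} [AddCommGroup T] [Module R T] (hfin : Module.Finite R T)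
    (hT : ∀ r ∈ m ^ s, ∀ x : T, r • x = 0) :
    ∀ j < i, Subsingleton (Abelian.Ext (ModuleCat.of R T) N j) := by
  revert hT
  induction hfin using IsNoetherianRing.induction_on_isQuotientEquivQuotientPrime with
  | subsingleton T => exact fun _ j _ => subsingleton_ext_of_subsingleton
  | quotient T p e =>
    intro hT j hj
    have hle : m ≤ p.1 := by
      refine Ideal.IsPrime.le_of_pow_le (n := s) fun r hr => ?_
      have h1 : r • (1 : R ⧸ p.1) = 0 := by
        rw [← e.apply_symm_apply 1, ← map_smul, hT r hr, map_zero]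
      rwa [Algebra.smul_def, mul_one, Ideal.Quotient.algebraMap_eq,
        Ideal.Quotient.eq_zero_iff_mem] at h1
    have heq : m = p.1 := Ideal.IsMaximal.eq_of_le ‹_› p.2.ne_top hle
    exact subsingleton_ext_of_linearEquiv
      ((Submodule.quotEquivOfEq _ _ heq).trans e.symm) (h j hj)
  | exact T₁ T₂ T₃ f g hf hg hfg h₁ h₃ =>
    intro hT j hj
    refine subsingleton_ext_of_exact f g hf hg hfg (h₁ (fun r hr x => hf ?_) j hj)
      (h₃ (fun r hr x => ?_) j hj)
    · rw [map_smul, hT r hr, map_zero]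
    · obtain ⟨y, rfl⟩ := hg x
      rw [← map_smul, hT r hr, map_zero]

lemma subsingleton_ext_of_isZero_localCohomology [IsNoetherianRing R] {m : Ideal R}
    [m.IsMaximal] {N : ModuleCat.{0} R} {d : ℕ}
    (h : ∀ i < d, IsZero ((localCohomology m i).obj N)) :
    ∀ i < d, Subsingleton (Abelian.Ext (ModuleCat.of R (R ⧸ m)) N i) := by
  intro i
  induction i using Nat.strong_induction_on with
  | _ i ih =>
    intro hi
    have ih' : ∀ j < i, Subsingleton (Abelian.Ext (ModuleCat.of R (R ⧸ m)) N j) :=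
      fun j hj => ih j hj (hj.trans hi)
    refine subsingleton_ext_of_linearEquiv (Submodule.quotEquivOfEq (m ^ 1) m (pow_one m))
      (subsingleton_of_forall_eq 0 fun α => ?_)
    obtain ⟨t, ht, hα⟩ := exists_mk₀_comp_eq_zero (h i hi) 1 α
    have hsurj : Function.Surjective
        (Submodule.mapQ (m ^ t) (m ^ 1) LinearMap.id (Ideal.pow_le_pow_right ht)) := by
      rintro ⟨x⟩
      exact ⟨Submodule.Quotient.mk x, rfl⟩
    obtain _ | i := i
    · have : Epi (ModuleCat.ofHom
        (Submodule.mapQ (m ^ t) (m ^ 1) LinearMap.id (Ideal.pow_le_pow_right ht))) :=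
        (ModuleCat.epi_iff_surjective _).mpr hsurj
      exact Abelian.Ext.precomp_mk₀_injective_of_epi N _
        (hα.trans (map_zero _).symm)
    · obtain ⟨β, rfl⟩ := Abelian.Ext.contravariant_sequence_exact₃
        (LinearMap.shortExact_shortComplexKer hsurj) N α hα (add_comm 1 i)
      have := subsingleton_ext_of_pow_smul_eq_zero ih' t (T := LinearMap.ker
        (Submodule.mapQ (m ^ t) (m ^ 1) LinearMap.id (Ideal.pow_le_pow_right ht)))
        inferInstance (fun r hr x => Subtype.ext (by
          obtain ⟨⟨x⟩, hx⟩ := x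
          exact (Submodule.Quotient.mk_eq_zero _).mpr (Ideal.mul_mem_right x _ hr))) i i.lt_succ_self
      rw [@Subsingleton.elim _ this β 0, Abelian.Ext.comp_zero]

end ExtVanishing

section ExtLocalVanishing

variable {R : Type} [CommRing R]

lemma exists_notMem_forall_smul_eq_zero_of_smul_mem [IsNoetherianRing R] {m : Ideal R} [m.IsPrime]
    {z f : R} (hz : z ∈ m) (hf : f ∉ m) {E : Type} [AddCommGroup E] [Module R E]
    [Module.Finite R E] (h : ∀ x : E, ∃ y : E, f • x = z • y) :
    ∃ r ∉ m, ∀ x : E, r • x = 0 := by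
  obtain ⟨p, hp, -, hcoeff, hann⟩ :=
    LinearMap.exists_monic_and_natDegree_eq_and_coeff_mem_pow_and_aeval_eq_zero R
      (algebraMap R (Module.End R E) f) (Ideal.span {z}) (by
        rintro _ ⟨x, rfl⟩
        obtain ⟨y, hy⟩ := h x
        rw [Module.algebraMap_end_apply, hy]
        exact Submodule.smul_mem_smul (Ideal.mem_span_singleton_self z) trivial)
  refine ⟨p.eval f, fun hmem => hf ?_, fun x => ?_⟩
  · rw [hp.as_sum] at hmem
    simp only [Polynomial.eval_add, Polynomial.eval_pow, Polynomial.eval_X,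
      Polynomial.eval_finsetSum, Polynomial.eval_mul, Polynomial.eval_C] at hmem
    refine Ideal.IsPrime.mem_of_pow_mem ‹_› p.natDegree
      ((Ideal.add_mem_iff_left _ (Ideal.sum_mem _ fun k hk => Ideal.mul_mem_right _ _ ?_)).mp hmem)
    have hk' : p.natDegree - k ≠ 0 := Nat.sub_ne_zero_of_lt (Finset.mem_range.mp hk)
    exact (Ideal.span_singleton_le_iff_mem m).mpr hz (Ideal.pow_le_self hk' (hcoeff k))
  · rw [Polynomial.aeval_algebraMap_apply, Polynomial.coe_aeval_eq_eval] at hann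
    simpa using LinearMap.congr_fun hann x

lemma exists_notMem_forall_smul_ext_eq_zero_of_succ [IsNoetherianRing R] {m : Ideal R} [m.IsPrime]
    {N : ModuleCat.{0} R} [Module.Finite R N] {Q Q' : Ideal R} {z : R} (hz : z ∈ m)
    (hQ : ∀ r, z * r ∈ Q → r ∈ Q) (hQ' : Q' = Q ⊔ Ideal.span {z}) {i : ℕ}
    (h : ∃ f ∉ m, ∀ α : Abelian.Ext (ModuleCat.of R (R ⧸ Q')) N (i + 1), f • α = 0) :
    ∃ f ∉ m, ∀ α : Abelian.Ext (ModuleCat.of R (R ⧸ Q)) N i, f • α = 0 := by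
  obtain ⟨f, hf, hα⟩ := h
  have hle : Q ≤ Q' := hQ' ▸ le_sup_left
  let T : ShortComplex (ModuleCat.{0} R) :=
    ShortComplex.mk (X₁ := ModuleCat.of R (R ⧸ Q)) (ModuleCat.ofHom (z • LinearMap.id))
      (ModuleCat.ofHom (Submodule.mapQ Q Q' LinearMap.id hle)) (by
        ext
        change (Submodule.Quotient.mk (z * 1) : R ⧸ Q') = 0
        rw [Submodule.Quotient.mk_eq_zero, mul_one, hQ']
        exact Ideal.mem_sup_right (Ideal.mem_span_singleton_self z))
  have hT : T.ShortExact := by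
    refine ModuleCat.shortComplex_shortExact T ?_ ?_ ?_
    · rintro ⟨r⟩
      change (Submodule.Quotient.mk r : R ⧸ Q') = 0 ↔ _
      rw [Submodule.Quotient.mk_eq_zero, hQ']
      constructor
      · intro hr
        obtain ⟨q, hq, w, hw, rfl⟩ := Submodule.mem_sup.mp hr
        obtain ⟨s, rfl⟩ := Ideal.mem_span_singleton'.mp hw
        refine ⟨Submodule.Quotient.mk s, ?_⟩
        change (Submodule.Quotient.mk (z * s) : R ⧸ Q) = Submodule.Quotient.mk (q + s * z)
        rw [Submodule.Quotient.eq]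
        convert Q.neg_mem hq using 1
        ring
      · rintro ⟨⟨s⟩, hs⟩
        have hs' : (Submodule.Quotient.mk (z * s) : R ⧸ Q) = Submodule.Quotient.mk r := hs
        rw [Submodule.Quotient.eq] at hs'
        have : r = -(z * s - r) + z * s := by ring
        rw [this]
        exact Submodule.add_mem_sup (Q.neg_mem hs')
          (Ideal.mul_mem_right _ _ (Ideal.mem_span_singleton_self z))
    · refine (injective_iff_map_eq_zero (ConcreteCategory.hom T.f)).mpr ?_
      rintro ⟨r⟩ hr
      exact (Submodule.Quotient.mk_eq_zero Q).mpr
        (hQ r ((Submodule.Quotient.mk_eq_zero Q (x := z * r)).mp hr))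
    · rintro ⟨r⟩
      exact ⟨Submodule.Quotient.mk r, rfl⟩
  refine exists_notMem_forall_smul_eq_zero_of_smul_mem hz hf fun α => ?_
  obtain ⟨β, hβ⟩ := Abelian.Ext.contravariant_sequence_exact₁ hT N (f • α) (add_comm 1 i)
    ((Abelian.Ext.comp_smul _ _ _ _).trans (hα _))
  refine ⟨β, hβ.symm.trans ?_⟩
  have h1 : T.f = z • 𝟙 (ModuleCat.of R (R ⧸ Q)) := rfl
  rw [h1, Abelian.Ext.mk₀_smul]
  exact (Abelian.Ext.smul_comp _ _ _ _).trans (congrArg (z • ·) (Abelian.Ext.mk₀_id_comp β))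

end ExtLocalVanishing

section HomLocalVanishing

variable {R : Type} [CommRing R]

lemma exists_notMem_smul_eq_zero_of_ext_zero {m Q : Ideal R} {N : Type} [AddCommGroup N]
    [Module R N]
    (h : ∃ f ∉ m, ∀ α : Abelian.Ext (ModuleCat.of R (R ⧸ Q)) (ModuleCat.of R N) 0, f • α = 0)
    (u : N) (hu : ∀ q ∈ Q, q • u = 0) : ∃ f ∉ m, f • u = 0 := by
  obtain ⟨f, hf, hα⟩ := h
  refine ⟨f, hf, ?_⟩
  have h1 := hα (Abelian.Ext.mk₀ (ModuleCat.ofHom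
    (Submodule.liftQ Q (LinearMap.toSpanSingleton R N u) hu)))
  rw [← Abelian.Ext.mk₀_smul, Abelian.Ext.mk₀_eq_zero_iff] at h1
  have h2 := ConcreteCategory.congr_hom h1 (Submodule.Quotient.mk (1 : R))
  change f • ((1 : R) • u) = 0 at h2
  rwa [one_smul] at h2

lemma exists_notMem_smul_eq_of_ext_one {m 𝔟 : Ideal R} {N : Type} [AddCommGroup N] [Module R N]
    (h : ∃ f ∉ m, ∀ α : Abelian.Ext (ModuleCat.of R (R ⧸ 𝔟)) (ModuleCat.of R N) 1, f • α = 0)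
    (φ : 𝔟 →ₗ[R] N) : ∃ f ∉ m, ∃ u : N, ∀ w : 𝔟, f • φ w = (w : R) • u := by
  obtain ⟨f, hf, hα⟩ := h
  let T : ShortComplex (ModuleCat.{0} R) :=
    ShortComplex.mk (X₁ := ModuleCat.of R 𝔟) (X₂ := ModuleCat.of R R)
      (X₃ := ModuleCat.of R (R ⧸ 𝔟)) (ModuleCat.ofHom 𝔟.subtype) (ModuleCat.ofHom 𝔟.mkQ) (by
        ext w
        exact (Submodule.Quotient.mk_eq_zero 𝔟).mpr w.2)
  have hT : T.ShortExact := ModuleCat.shortComplex_shortExact T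
    (LinearMap.exact_subtype_mkQ 𝔟) 𝔟.injective_subtype 𝔟.mkQ_surjective
  obtain ⟨β, hβ⟩ := Abelian.Ext.contravariant_sequence_exact₁ hT (ModuleCat.of R N)
    (f • Abelian.Ext.mk₀ (ModuleCat.ofHom φ)) (add_zero 1)
    ((Abelian.Ext.comp_smul _ _ _ _).trans (hα _))
  obtain ⟨g, rfl⟩ := Abelian.Ext.addEquiv₀.symm.surjective β
  refine ⟨f, hf, ConcreteCategory.hom g (1 : R), fun w => ?_⟩
  rw [Abelian.Ext.addEquiv₀_symm_apply, Abelian.Ext.mk₀_comp_mk₀, ← Abelian.Ext.mk₀_smul] at hβ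
  have h2 := ConcreteCategory.congr_hom ((Abelian.Ext.mk₀_bijective _ _).1 hβ) w
  change ConcreteCategory.hom g (w : R) = f • φ w at h2
  rw [← h2, ← map_smul, smul_eq_mul, mul_one]

end HomLocalVanishing

section VarIdeal

variable {k σ : Type} [Field k]

/-- The prime ideal generated by a set of variables. -/
def varIdeal (k : Type) [Field k] {σ : Type} (A : Set σ) : Ideal (MvPolynomial σ k) :=
  Ideal.span (X '' A)

open Classical in
/-- The substitution setting a given set of variables to zero. -/
def killVars (k : Type) [Field k] {σ : Type} (A : Set σ) :
    MvPolynomial σ k →ₐ[k] MvPolynomial σ k :=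
  aeval fun v => if v ∈ A then 0 else X v

lemma killVars_X_of_mem {A : Set σ} {v : σ} (hv : v ∈ A) : killVars k A (X v) = 0 := by
  simp [killVars, hv]

lemma killVars_X_of_notMem {A : Set σ} {v : σ} (hv : v ∉ A) : killVars k A (X v) = X v := by
  simp [killVars, hv]

lemma X_mem_varIdeal {A : Set σ} {v : σ} (hv : v ∈ A) : X v ∈ varIdeal k A :=
  Ideal.subset_span ⟨v, hv, rfl⟩

lemma varIdeal_le_iff {A : Set σ} {J : Ideal (MvPolynomial σ k)} :
    varIdeal k A ≤ J ↔ ∀ v ∈ A, X v ∈ J := by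
  simp [varIdeal, Ideal.span_le, Set.subset_def]

lemma sub_killVars_mem (A : Set σ) (p : MvPolynomial σ k) :
    p - killVars k A p ∈ varIdeal k A := by
  induction p using MvPolynomial.induction_on with
  | C a => simp [killVars]
  | add p q hp hq =>
    rw [map_add, add_sub_add_comm]
    exact add_mem hp hq
  | mul_X p v hp =>
    by_cases hv : v ∈ A
    · rw [map_mul, killVars_X_of_mem hv, mul_zero, sub_zero]
      exact Ideal.mul_mem_left _ _ (X_mem_varIdeal hv)
    · rw [map_mul, killVars_X_of_notMem hv, ← sub_mul]
      exact Ideal.mul_mem_right _ _ hp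

lemma varIdeal_eq_ker (A : Set σ) : varIdeal k A = RingHom.ker (killVars k A) := by
  refine le_antisymm (varIdeal_le_iff.mpr fun v hv => killVars_X_of_mem hv) fun p hp => ?_
  simpa [RingHom.mem_ker.mp hp] using sub_killVars_mem A p

instance varIdeal_isPrime (A : Set σ) : (varIdeal k A).IsPrime := by
  rw [varIdeal_eq_ker]
  exact RingHom.ker_isPrime _

lemma X_notMem_varIdeal {A : Set σ} {v : σ} (hv : v ∉ A) :
    (X v : MvPolynomial σ k) ∉ varIdeal k A := by
  rw [varIdeal_eq_ker, RingHom.mem_ker, killVars_X_of_notMem hv]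
  exact X_ne_zero v

lemma varIdeal_univ : varIdeal k (Set.univ : Set σ) = maxIdeal k σ := by
  rw [varIdeal, Set.image_univ, maxIdeal]

lemma varIdeal_le_maxIdeal (A : Set σ) : varIdeal k A ≤ maxIdeal k σ :=
  varIdeal_univ (k := k) ▸ Ideal.span_mono (Set.image_mono (Set.subset_univ A))

instance maxIdeal_isMaximal : (maxIdeal k σ).IsMaximal := by
  have : maxIdeal k σ = RingHom.ker (constantCoeff : MvPolynomial σ k →+* k) := by
    refine le_antisymm (Ideal.span_le.mpr ?_) fun p hp => ?_
    · rintro _ ⟨v, rfl⟩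
      exact constantCoeff_X k v
    · have hkill : killVars k (Set.univ : Set σ) p = C (constantCoeff p) := by
        simp only [killVars, Set.mem_univ, if_true]
        exact aeval_zero' p
      rw [← varIdeal_univ, varIdeal_eq_ker, RingHom.mem_ker, hkill, RingHom.mem_ker.mp hp, C_0]
  rw [this]
  exact RingHom.ker_isMaximal_of_surjective _ fun a => ⟨C a, constantCoeff_C _ a⟩

/-- A form of Ischebeck's theorem for ideals of variables: below the depth, `Ext` vanishes
locally at the irrelevant ideal. -/
lemma exists_notMem_forall_smul_ext_varIdeal_eq_zero [Finite σ] {N : Type} [AddCommGroup N]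
    [Module (MvPolynomial σ k) N] [Module.Finite (MvPolynomial σ k) N] {d : ℕ}
    (h : ∀ i < d, Subsingleton (Abelian.Ext
      (ModuleCat.of (MvPolynomial σ k) (MvPolynomial σ k ⧸ maxIdeal k σ))
      (ModuleCat.of (MvPolynomial σ k) N) i))
    (A : Set σ) (i : ℕ) (hi : i + Aᶜ.ncard < d) :
    ∃ f ∉ maxIdeal k σ, ∀ α : Abelian.Ext
      (ModuleCat.of (MvPolynomial σ k) (MvPolynomial σ k ⧸ varIdeal k A))
      (ModuleCat.of (MvPolynomial σ k) N) i, f • α = 0 := by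
  generalize hc : Aᶜ.ncard = c at hi
  induction c generalizing A i with
  | zero =>
    obtain rfl : A = Set.univ := by
      rwa [Set.ncard_eq_zero, Set.compl_empty_iff] at hc
    rw [varIdeal_univ]
    exact ⟨1, (Ideal.ne_top_iff_one _).mp Ideal.IsPrime.ne_top', fun α =>
      @Subsingleton.elim _ (h i hi) _ _⟩
  | succ c ih =>
    obtain ⟨v, hv⟩ : Aᶜ.Nonempty := (Set.ncard_pos (Set.toFinite _)).mp (by omega)
    refine exists_notMem_forall_smul_ext_eq_zero_of_succ (m := maxIdeal k σ) (z := X v)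
      (Q' := varIdeal k (insert v A)) (Ideal.subset_span ⟨v, rfl⟩)
      (fun r hr => ((varIdeal_isPrime A).mem_or_mem hr).resolve_left (X_notMem_varIdeal hv))
      ?_ (ih (insert v A) (i + 1) ?_ (by omega))
    · rw [varIdeal, varIdeal, Set.image_insert_eq, Ideal.span_insert, sup_comm]
    · have := Set.ncard_sdiff_singleton_of_mem hv
      have h2 : (insert v A)ᶜ = Aᶜ \ {v} := by
        ext w
        simp [not_or, and_comm]
      rw [h2, this, hc, Nat.add_sub_cancel]

end VarIdeal

section LocalExtension

variable {R W : Type} [CommRing R] [AddCommGroup W] [Module R W]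

/-- Every element of `B / A` killed by `Q` vanishes locally at `m`. -/
def LocallyTorsionFree (m Q : Ideal R) (A B : Submodule R W) : Prop :=
  ∀ u ∈ B, (∀ q ∈ Q, q • u ∈ A) → ∃ f ∉ m, f • u ∈ A

/-- Every linear map `𝔟 → B / A` is, locally at `m`, multiplication by an element of `B / A`. -/
def LocallyExtends (m 𝔟 : Ideal R) (A B : Submodule R W) : Prop :=
  ∀ φ : 𝔟 → W, (∀ w, φ w ∈ B) → (∀ w w', φ (w + w') - (φ w + φ w') ∈ A) →
    (∀ (s : R) w, φ (s • w) - s • φ w ∈ A) →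
    ∃ g ∉ m, ∃ u ∈ B, ∀ w : 𝔟, g • φ w - (w : R) • u ∈ A

lemma LocallyTorsionFree.trans {m Q : Ideal R} [m.IsPrime] {A B C : Submodule R W} (hAB : A ≤ B)
    (h₁ : LocallyTorsionFree m Q A B) (h₂ : LocallyTorsionFree m Q B C) :
    LocallyTorsionFree m Q A C := by
  intro u hu hq
  obtain ⟨f, hf, hfu⟩ := h₂ u hu fun q hqQ => hAB (hq q hqQ)
  obtain ⟨g, hg, hgu⟩ := h₁ (f • u) hfu fun q hqQ => by
    rw [smul_comm]
    exact A.smul_mem f (hq q hqQ)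
  exact ⟨g * f, ‹m.IsPrime›.mul_notMem hg hf, by rwa [mul_smul]⟩

lemma LocallyExtends.trans {m 𝔟 : Ideal R} [m.IsPrime] {A B C : Submodule R W} (hAB : A ≤ B)
    (hBC : B ≤ C) (h₁ : LocallyExtends m 𝔟 A B) (h₂ : LocallyExtends m 𝔟 B C) :
    LocallyExtends m 𝔟 A C := by
  intro φ hφ hadd hsmul
  obtain ⟨f, hf, u, hu, hfu⟩ := h₂ φ hφ (fun w w' => hAB (hadd w w')) fun s w => hAB (hsmul s w)
  obtain ⟨g, hg, v, hv, hgv⟩ := h₁ (fun w => f • φ w - (w : R) • u) hfu (fun w w' => by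
      convert A.smul_mem f (hadd w w') using 1
      rw [Submodule.coe_add]
      module) fun s w => by
      convert A.smul_mem f (hsmul s w) using 1
      rw [Submodule.coe_smul, smul_eq_mul]
      module
  refine ⟨g * f, ‹m.IsPrime›.mul_notMem hg hf, g • u + v,
    C.add_mem (C.smul_mem g hu) (hBC hv), fun w => ?_⟩
  convert hgv w using 1
  module

lemma locallyTorsionFree_of_ext {m Q : Ideal R} {A B : Submodule R W}
    (h : ∃ f ∉ m, ∀ α : Abelian.Ext (ModuleCat.of R (R ⧸ Q))
      (ModuleCat.of R (↥B ⧸ Submodule.comap B.subtype A)) 0, f • α = 0) :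
    LocallyTorsionFree m Q A B := by
  intro u hu hq
  obtain ⟨f, hf, hfu⟩ := exists_notMem_smul_eq_zero_of_ext_zero h
    (Submodule.Quotient.mk ⟨u, hu⟩) fun q hqQ => (Submodule.Quotient.mk_eq_zero _).mpr (hq q hqQ)
  exact ⟨f, hf, (Submodule.Quotient.mk_eq_zero (Submodule.comap B.subtype A)
    (x := f • (⟨u, hu⟩ : B))).mp hfu⟩

lemma locallyExtends_of_ext {m 𝔟 : Ideal R} {A B : Submodule R W}
    (h : ∃ f ∉ m, ∀ α : Abelian.Ext (ModuleCat.of R (R ⧸ 𝔟))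
      (ModuleCat.of R (↥B ⧸ Submodule.comap B.subtype A)) 1, f • α = 0) :
    LocallyExtends m 𝔟 A B := by
  intro φ hφ hadd hsmul
  let ψ : 𝔟 →ₗ[R] (↥B ⧸ Submodule.comap B.subtype A) :=
    { toFun := fun w => Submodule.Quotient.mk ⟨φ w, hφ w⟩
      map_add' := fun w w' => (Submodule.Quotient.eq (Submodule.comap B.subtype A)
        (x := ⟨φ (w + w'), hφ (w + w')⟩) (y := (⟨φ w, hφ w⟩ : B) + (⟨φ w', hφ w'⟩ : B))).mpr (hadd w w')
      map_smul' := fun s w => (Submodule.Quotient.eq (Submodule.comap B.subtype A)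
        (x := ⟨φ (s • w), hφ (s • w)⟩) (y := s • (⟨φ w, hφ w⟩ : B))).mpr (hsmul s w) }
  obtain ⟨g, hg, u, hgu⟩ := exists_notMem_smul_eq_of_ext_one h ψ
  obtain ⟨⟨u, hu⟩, rfl⟩ := Submodule.Quotient.mk_surjective _ u
  exact ⟨g, hg, u, hu, fun w => (Submodule.Quotient.eq (Submodule.comap B.subtype A)
    (x := g • (⟨φ w, hφ w⟩ : B)) (y := (w : R) • (⟨u, hu⟩ : B))).mp (hgu w)⟩

lemma locallyTorsionFree_chain {m Q : Ideal R} [m.IsPrime] {M : ℕ → Submodule R W} {a r : ℕ}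
    (har : a ≤ r) (hM : ∀ i < r, M i ≤ M (i + 1))
    (h : ∀ i, a ≤ i → i < r → LocallyTorsionFree m Q (M i) (M (i + 1))) :
    LocallyTorsionFree m Q (M a) (M r) ∧ M a ≤ M r := by
  induction r, har using Nat.le_induction with
  | base => exact ⟨fun u hu _ => ⟨1, (Ideal.ne_top_iff_one _).mp Ideal.IsPrime.ne_top', by
      rwa [one_smul]⟩, le_rfl⟩
  | succ r har ih =>
    obtain ⟨h₁, h₂⟩ := ih (fun i hi => hM i (by omega)) fun i hi hi' => h i hi (by omega)
    exact ⟨h₁.trans h₂ (h r har (by omega)), h₂.trans (hM r (by omega))⟩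

lemma locallyExtends_chain {m 𝔟 : Ideal R} [m.IsPrime] {M : ℕ → Submodule R W} {a r : ℕ}
    (har : a ≤ r) (hM : ∀ i < r, M i ≤ M (i + 1))
    (h : ∀ i, a ≤ i → i < r → LocallyExtends m 𝔟 (M i) (M (i + 1))) :
    LocallyExtends m 𝔟 (M a) (M r) ∧ M a ≤ M r := by
  induction r, har using Nat.le_induction with
  | base => exact ⟨fun φ hφ _ _ => ⟨1, (Ideal.ne_top_iff_one _).mp Ideal.IsPrime.ne_top', 0,
      zero_mem _, fun w => by simpa using hφ w⟩, le_rfl⟩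
  | succ r har ih =>
    obtain ⟨h₁, h₂⟩ := ih (fun i hi => hM i (by omega)) fun i hi hi' => h i hi (by omega)
    exact ⟨h₁.trans h₂ (hM r (by omega)) (h r har (by omega)), h₂.trans (hM r (by omega))⟩

end LocalExtension

section DimensionFiltration

variable {k σ : Type} [Field k] [Finite σ]

lemma natCast_ncard_le_ringKrullDim_quotient {J : Ideal (MvPolynomial σ k)} {V : Set σ}
    (hJ : J ≤ varIdeal k V) :
    (Vᶜ.ncard : WithBot ℕ∞) ≤ ringKrullDim (MvPolynomial σ k ⧸ J) := by
  classical
  let π : MvPolynomial σ k →ₐ[k] MvPolynomial ↥Vᶜ k :=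
    aeval fun v => if h : v ∈ V then 0 else X ⟨v, h⟩
  have hπ : Function.Surjective π := by
    rw [← AlgHom.range_eq_top, ← top_le_iff, ← MvPolynomial.adjoin_range_X, Algebra.adjoin_le_iff]
    rintro _ ⟨⟨v, hv⟩, rfl⟩
    exact ⟨X v, by simpa [π] using dif_neg hv⟩
  have hker : varIdeal k V ≤ RingHom.ker π := varIdeal_le_iff.mpr fun v hv => by
    simp [π, RingHom.mem_ker, hv]
  have h1 := ringKrullDim_le_of_surjective
    (Ideal.Quotient.lift J (π : MvPolynomial σ k →+* MvPolynomial ↥Vᶜ k)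
      fun a ha => hker (hJ ha))
    (Ideal.Quotient.lift_surjective_of_surjective _ _ hπ)
  rwa [MvPolynomial.ringKrullDim_of_isNoetherianRing, ringKrullDim_eq_zero_of_field, zero_add,
    Nat.card_coe_set_eq] at h1

/-- A sequentially Cohen–Macaulay quotient has a submodule collecting the part of dimension less
than `d`, modulo which `Hom` and `Ext¹` out of quotients by small sets of variables vanish
locally. -/
lemma IsSCMIdeal.exists_submodule {I : Ideal (MvPolynomial σ k)} (hI : IsSCMIdeal k σ I) (d : ℕ) :
    ∃ A : Submodule (MvPolynomial σ k) (MvPolynomial σ k ⧸ I),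
      (∀ V : Set σ, Vᶜ.ncard < d → LocallyTorsionFree (maxIdeal k σ) (varIdeal k V) A ⊤) ∧
      (∀ V : Set σ, 1 + Vᶜ.ncard < d → LocallyExtends (maxIdeal k σ) (varIdeal k V) A ⊤) ∧
      ∀ V : Set σ, I ≤ varIdeal k V → d ≤ Vᶜ.ncard →
        ∀ s, Ideal.Quotient.mk I s ∈ A → s ∈ varIdeal k V := by
  obtain ⟨r, M, hM0, hMr, hlt, -, hCM, hdim⟩ := hI
  let D : ℕ → WithBot ℕ∞ := fun i => moduleDim (MvPolynomial σ k)
    (↥(M (i + 1)) ⧸ Submodule.comap (M (i + 1)).subtype (M i))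
  have hex : ∃ i, r ≤ i ∨ (d : WithBot ℕ∞) ≤ D i := ⟨r, Or.inl le_rfl⟩
  classical
  obtain ⟨a, ha, hmin⟩ : ∃ a, (r ≤ a ∨ (d : WithBot ℕ∞) ≤ D a) ∧
      ∀ i < a, ¬ (r ≤ i ∨ (d : WithBot ℕ∞) ≤ D i) :=
    ⟨Nat.find hex, Nat.find_spec hex, fun i hi => Nat.find_min hex hi⟩
  have har : a ≤ r := by
    by_contra h
    exact hmin r (by omega) (Or.inl le_rfl)
  have hD : ∀ i, a ≤ i → i < r → (d : WithBot ℕ∞) ≤ D i := by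
    intro i hi
    induction i, hi using Nat.le_induction with
    | base => exact fun h => ha.resolve_left (by omega)
    | succ i hi ih => exact fun h => (ih (by omega)).trans (hdim i (by omega)).le
  have hext : ∀ i, a ≤ i → i < r → ∀ j < d, Subsingleton (Abelian.Ext
      (ModuleCat.of (MvPolynomial σ k) (MvPolynomial σ k ⧸ maxIdeal k σ))
      (ModuleCat.of (MvPolynomial σ k)
        (↥(M (i + 1)) ⧸ Submodule.comap (M (i + 1)).subtype (M i))) j) := fun i hi hir =>
    subsingleton_ext_of_isZero_localCohomology fun j hj =>
      hCM i hir j (lt_of_lt_of_le (by exact_mod_cast hj) (hD i hi hir))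
  refine ⟨M a, fun V hV => ?_, fun V hV => ?_, fun V hIV hV => ?_⟩
  · rw [← hMr]
    exact (locallyTorsionFree_chain har (fun i hi => (hlt i hi).le) fun i hi hir =>
      locallyTorsionFree_of_ext (exists_notMem_forall_smul_ext_varIdeal_eq_zero (hext i hi hir) V 0
        (by omega))).1
  · rw [← hMr]
    exact (locallyExtends_chain har (fun i hi => (hlt i hi).le) fun i hi hir =>
      locallyExtends_of_ext (exists_notMem_forall_smul_ext_varIdeal_eq_zero (hext i hi hir) V 1
        hV)).1
  · suffices H : ∀ i ≤ a, ∀ s, Ideal.Quotient.mk I s ∈ M i → s ∈ varIdeal k V from H a le_rfl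
    intro i
    induction i with
    | zero =>
      intro _ s hs
      rw [hM0, Submodule.mem_bot, Ideal.Quotient.eq_zero_iff_mem] at hs
      exact hIV hs
    | succ i ih =>
      intro hia s hs
      have hnle : ¬ Module.annihilator (MvPolynomial σ k)
          (↥(M (i + 1)) ⧸ Submodule.comap (M (i + 1)).subtype (M i)) ≤ varIdeal k V := fun hle =>
        hmin i (by omega) (Or.inr ((by exact_mod_cast hV : (d : WithBot ℕ∞) ≤ Vᶜ.ncard).trans
          (natCast_ncard_le_ringKrullDim_quotient hle)))
      obtain ⟨b, hb, hbV⟩ := SetLike.not_le_iff_exists.mp hnle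
      have h1 := Module.mem_annihilator.mp hb
        (Submodule.Quotient.mk ⟨Ideal.Quotient.mk I s, hs⟩)
      have h2 : b • Ideal.Quotient.mk I s ∈ M i :=
        (Submodule.Quotient.mk_eq_zero (Submodule.comap (M (i + 1)).subtype (M i))
          (x := b • (⟨Ideal.Quotient.mk I s, hs⟩ : M (i + 1)))).mp h1
      exact ((varIdeal_isPrime V).mem_or_mem (ih (by omega) (b * s) h2)).resolve_left hbV

end DimensionFiltration

lemma exists_repeat_and_gap_of_not_isSaturated {n : ℕ} {lam : ℕ → ℕ} (hpart : IsPartitionFn n lam)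
    (hnotsat : ¬ IsSaturated n lam) :
    ∃ a e, a < e ∧ lam a = lam (a + 1) ∧ lam (e + 1) + 2 ≤ lam e ∧
      ∀ c, a < c → c < e → lam (c + 1) + 1 = lam c := by
  classical
  obtain ⟨-, hanti, hpos, hzero⟩ := hpart
  rw [IsSaturated, not_or] at hnotsat
  obtain ⟨hstrict, hmiss⟩ := hnotsat
  have hrep : ∃ i, i + 1 < n ∧ lam i = lam (i + 1) := by
    by_contra! hne
    refine hstrict fun x hx y hy hxy => ?_
    have h1 := hanti hxy.le
    have h2 := hanti (Nat.succ_le_of_lt hxy)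
    have h3 := hanti (Nat.le_succ x)
    have h4 := hne x (lt_of_le_of_lt hxy hy)
    simp only [Nat.succ_eq_add_one] at h2 h3
    omega
  obtain ⟨i, ⟨hin, hi⟩, himin⟩ : ∃ i, (i + 1 < n ∧ lam i = lam (i + 1)) ∧
      ∀ j < i, ¬ (j + 1 < n ∧ lam j = lam (j + 1)) :=
    ⟨Nat.find hrep, Nat.find_spec hrep, fun j hj => Nat.find_min hrep hj⟩
  obtain ⟨v, hv, hvi, hvne⟩ : ∃ v, 0 < v ∧ v ≤ lam i ∧ ∀ a < n, lam a ≠ v := by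
    by_contra! h
    exact hmiss ⟨i, hin, hi, fun j hj h' => himin j hj ⟨by omega, h'⟩, h⟩
  have hvne' : ∀ a, lam a ≠ v := fun a => by
    rcases lt_or_ge a n with h | h
    · exact hvne a h
    · rw [hzero a h]
      exact hv.ne
  have hsmall : ∃ x, lam x < v := ⟨n, by rwa [hzero n le_rfl]⟩
  obtain ⟨x, hx, hxmin⟩ : ∃ x, lam x < v ∧ ∀ y < x, ¬ lam y < v :=
    ⟨Nat.find hsmall, Nat.find_spec hsmall, fun j hj => Nat.find_min hsmall hj⟩
  have hix : i + 1 < x := by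
    by_contra! h
    have := hanti h
    omega
  have hgap : ∃ e, i + 1 ≤ e ∧ lam (e + 1) + 2 ≤ lam e := by
    refine ⟨x - 1, by omega, ?_⟩
    have h1 := hxmin (x - 1) (by omega)
    have h2 := hvne' (x - 1)
    rw [Nat.sub_add_cancel (by omega)]
    omega
  obtain ⟨e, ⟨hie, he⟩, hemin⟩ : ∃ e, (i + 1 ≤ e ∧ lam (e + 1) + 2 ≤ lam e) ∧
      ∀ c < e, ¬ (i + 1 ≤ c ∧ lam (c + 1) + 2 ≤ lam c) :=
    ⟨Nat.find hgap, Nat.find_spec hgap, fun j hj => Nat.find_min hgap hj⟩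
  let P : ℕ → Prop := fun a => i ≤ a ∧ a + 1 ≤ e ∧ lam a = lam (a + 1)
  have hP : P (Nat.findGreatest P e) :=
    Nat.findGreatest_spec (show i ≤ e by omega) ⟨le_rfl, hie, hi⟩
  refine ⟨Nat.findGreatest P e, e, hP.2.1, hP.2.2, he, fun c hac hce => ?_⟩
  have h1 : ¬ P c := Nat.findGreatest_is_greatest hac hce.le
  have h2 := hemin c hce
  have h3 := hanti (Nat.le_succ c)
  have h4 := hP.1
  simp only [P, Nat.succ_eq_add_one] at h1 h3
  omega

section LocalSaturation

variable {R W : Type} [CommRing R] [AddCommGroup W] [Module R W]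

/-- The elements lying in `A` locally at the prime `m`. -/
def localSaturation (m : Ideal R) [hm : m.IsPrime] (A : Submodule R W) : Submodule R W where
  carrier := {u | ∃ f ∉ m, f • u ∈ A}
  zero_mem' := ⟨1, (Ideal.ne_top_iff_one _).mp Ideal.IsPrime.ne_top', by simp⟩
  add_mem' := by
    rintro u v ⟨f, hf, hfu⟩ ⟨g, hg, hgv⟩
    refine ⟨f * g, hm.mul_notMem hf hg, ?_⟩
    convert A.add_mem (A.smul_mem g hfu) (A.smul_mem f hgv) using 1
    module
  smul_mem' := by
    rintro s u ⟨f, hf, hfu⟩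
    exact ⟨f, hf, by rw [smul_comm]; exact A.smul_mem s hfu⟩

lemma exists_notMem_forall_smul_mem [IsNoetherian R W] (m : Ideal R) [hm : m.IsPrime]
    (A : Submodule R W) : ∃ f ∉ m, ∀ u ∈ localSaturation m A, f • u ∈ A := by
  suffices H : ∀ N : Submodule R W, N ≤ localSaturation m A → ∃ f ∉ m, ∀ u ∈ N, f • u ∈ A from
    H _ le_rfl
  intro N
  have hN : N.FG := IsNoetherian.noetherian N
  induction N, hN using Submodule.fg_induction with
  | singleton x =>
    intro hx
    obtain ⟨f, hf, hfx⟩ := hx (Submodule.mem_span_singleton_self x)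
    refine ⟨f, hf, fun u hu => ?_⟩
    obtain ⟨s, rfl⟩ := Submodule.mem_span_singleton.mp hu
    rw [smul_comm]
    exact A.smul_mem s hfx
  | sup N₁ N₂ _ _ h₁ h₂ =>
    intro h
    obtain ⟨f, hf, hfN⟩ := h₁ (le_sup_left.trans h)
    obtain ⟨g, hg, hgN⟩ := h₂ (le_sup_right.trans h)
    refine ⟨f * g, hm.mul_notMem hf hg, fun u hu => ?_⟩
    obtain ⟨v, hv, w, hw, rfl⟩ := Submodule.mem_sup.mp hu
    convert A.add_mem (A.smul_mem g (hfN v hv)) (A.smul_mem f (hgN w hw)) using 1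
    module

end LocalSaturation

section Corner

variable {k : Type} [Field k]

lemma LocallyTorsionFree.mem_localSaturation {σ W : Type} [Finite σ] [AddCommGroup W]
    [Module (MvPolynomial σ k) W] [IsNoetherian (MvPolynomial σ k) W]
    {A : Submodule (MvPolynomial σ k) W} {V : Set σ}
    (h : LocallyTorsionFree (maxIdeal k σ) (varIdeal k V) A ⊤) {u : W}
    (hu : ∀ v ∈ V, (X v : MvPolynomial σ k) • u ∈ localSaturation (maxIdeal k σ) A) :
    u ∈ localSaturation (maxIdeal k σ) A := by
  obtain ⟨F, hF, hFA⟩ := exists_notMem_forall_smul_mem (maxIdeal k σ) A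
  have hle : varIdeal k V ≤ Submodule.comap
      (LinearMap.toSpanSingleton (MvPolynomial σ k) W (F • u)) A :=
    varIdeal_le_iff.mpr fun v hv => by
      rw [Submodule.mem_comap, LinearMap.toSpanSingleton_apply, smul_comm]
      exact hFA _ (hu v hv)
  obtain ⟨f, hf, hfu⟩ := h (F • u) trivial fun q hq => hle hq
  exact ⟨f * F, Ideal.IsPrime.mul_notMem inferInstance hf hF, by rwa [mul_smul]⟩

/-- The variables `x_i` with `i < p` and `y_j` with `j < q`. -/
def cornerVars (n m p q : ℕ) : Set (Fin n ⊕ Fin m) :=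
  {v | Sum.elim (fun i : Fin n => (i : ℕ) < p) (fun j : Fin m => (j : ℕ) < q) v}

lemma inl_mem_cornerVars {n m p q : ℕ} {i : Fin n} :
    Sum.inl i ∈ cornerVars n m p q ↔ (i : ℕ) < p := Iff.rfl

lemma inr_mem_cornerVars {n m p q : ℕ} {j : Fin m} :
    Sum.inr j ∈ cornerVars n m p q ↔ (j : ℕ) < q := Iff.rfl

lemma ncard_setOf_le_val (n p : ℕ) : {i : Fin n | p ≤ (i : ℕ)}.ncard = n - p := by
  rw [← Set.ncard_image_of_injective _ Fin.val_injective]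
  have : Fin.val '' {i : Fin n | p ≤ (i : ℕ)} = ↑(Finset.Ico p n) := by
    ext x
    simp only [Set.mem_image, Set.mem_ofPred_eq, Finset.coe_Ico, Set.mem_Ico]
    exact ⟨by rintro ⟨i, hi, rfl⟩; exact ⟨hi, i.2⟩, fun h => ⟨⟨x, h.2⟩, h.1, rfl⟩⟩
  rw [this, Set.ncard_coe_finset, Nat.card_Ico]

lemma ncard_compl_cornerVars (n m p q : ℕ) :
    (cornerVars n m p q)ᶜ.ncard = (n - p) + (m - q) := by
  have : (cornerVars n m p q)ᶜ =
      Sum.inl '' {i : Fin n | p ≤ (i : ℕ)} ∪ Sum.inr '' {j : Fin m | q ≤ (j : ℕ)} := by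
    ext v
    rcases v with i | j <;> simp [cornerVars]
  rw [this, Set.ncard_union_eq Set.disjoint_image_inl_image_inr,
    Set.ncard_image_of_injective _ Sum.inl_injective,
    Set.ncard_image_of_injective _ Sum.inr_injective, ncard_setOf_le_val, ncard_setOf_le_val]

variable {n : ℕ} {lam : ℕ → ℕ}

lemma X_mul_X_mem_skewIdeal {i : Fin n} {j : Fin (lam 0)} (h : (j : ℕ) < lam i) :
    (X (Sum.inl i) * X (Sum.inr j) : MvPolynomial (Fin n ⊕ Fin (lam 0)) k) ∈
      skewIdeal k n lam fun _ => 0 :=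
  Ideal.subset_span ⟨i, j, Nat.zero_le _, h, rfl⟩

lemma skewIdeal_le_varIdeal (hanti : Antitone lam) (c : ℕ) :
    skewIdeal k n lam (fun _ => 0) ≤ varIdeal k (cornerVars n (lam 0) c (lam c)) := by
  refine Ideal.span_le.mpr ?_
  rintro _ ⟨i, j, -, hj, rfl⟩
  rcases lt_or_ge (i : ℕ) c with h | h
  · exact Ideal.mul_mem_right _ _ (X_mem_varIdeal (inl_mem_cornerVars.mpr h))
  · exact Ideal.mul_mem_left _ _
      (X_mem_varIdeal (inr_mem_cornerVars.mpr (hj.trans_le (hanti h))))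

end Corner

section NotSequentiallyCohenMacaulay

variable {k : Type} [Field k] {n : ℕ} {lam : ℕ → ℕ}

lemma mk_X_mul_X_mem_localSaturation (hanti : Antitone lam) {a e : ℕ}
    {A : Submodule (MvPolynomial (Fin n ⊕ Fin (lam 0)) k)
      (MvPolynomial (Fin n ⊕ Fin (lam 0)) k ⧸ skewIdeal k n lam fun _ => 0)}
    (hA : ∀ c, a < c → c < e → LocallyTorsionFree (maxIdeal k _)
      (varIdeal k (cornerVars n (lam 0) (c + 1) (lam (c + 1)))) A ⊤) (hae : a < e)
    (i : Fin n) (hi : (i : ℕ) ≤ e) (j : Fin (lam 0)) (hj : (j : ℕ) < lam (a + 1)) :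
    Ideal.Quotient.mk (skewIdeal k n lam fun _ => 0) (X (Sum.inl i) * X (Sum.inr j)) ∈
      localSaturation (maxIdeal k _) A := by
  have hzero : ∀ (p : Fin n) (q : Fin (lam 0)), (q : ℕ) < lam p →
      Ideal.Quotient.mk (skewIdeal k n lam fun _ => 0) (X (Sum.inl p) * X (Sum.inr q)) = 0 :=
    fun p q h => Ideal.Quotient.eq_zero_iff_mem.mpr (X_mul_X_mem_skewIdeal h)
  suffices H : ∀ t c, c + 1 + t = e → a ≤ c → ∀ j : Fin (lam 0), (j : ℕ) < lam (c + 1) →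
      Ideal.Quotient.mk (skewIdeal k n lam fun _ => 0) (X (Sum.inl i) * X (Sum.inr j)) ∈
        localSaturation (maxIdeal k _) A from H (e - (a + 1)) a (by omega) le_rfl j hj
  intro t
  induction t with
  | zero =>
    intro c hc _ j hj
    rw [hzero i j (hj.trans_le (hanti (by omega)))]
    exact zero_mem _
  | succ t ih =>
    intro c hc hac j hj
    refine (hA (c + 1) (by omega) (by omega)).mem_localSaturation fun v hv => ?_
    rcases v with p | q
    · rw [inl_mem_cornerVars] at hv
      have : (X (Sum.inl p) : MvPolynomial (Fin n ⊕ Fin (lam 0)) k) •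
          Ideal.Quotient.mk (skewIdeal k n lam fun _ => 0) (X (Sum.inl i) * X (Sum.inr j)) =
          (X (Sum.inl i) : MvPolynomial (Fin n ⊕ Fin (lam 0)) k) •
          Ideal.Quotient.mk (skewIdeal k n lam fun _ => 0) (X (Sum.inl p) * X (Sum.inr j)) :=
        congrArg (Ideal.Quotient.mk _) (mul_left_comm _ _ _)
      rw [this, hzero p j (hj.trans_le (hanti (by omega))), smul_zero]
      exact zero_mem _
    · rw [inr_mem_cornerVars] at hv
      have : (X (Sum.inr q) : MvPolynomial (Fin n ⊕ Fin (lam 0)) k) •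
          Ideal.Quotient.mk (skewIdeal k n lam fun _ => 0) (X (Sum.inl i) * X (Sum.inr j)) =
          (X (Sum.inr j) : MvPolynomial (Fin n ⊕ Fin (lam 0)) k) •
          Ideal.Quotient.mk (skewIdeal k n lam fun _ => 0) (X (Sum.inl i) * X (Sum.inr q)) :=
        congrArg (Ideal.Quotient.mk _)
          (by ring : (X (Sum.inr q) : MvPolynomial (Fin n ⊕ Fin (lam 0)) k) *
            (X (Sum.inl i) * X (Sum.inr j)) = X (Sum.inr j) * (X (Sum.inl i) * X (Sum.inr q)))
      rw [this]
      exact Submodule.smul_mem _ _ (ih (c + 1) (by omega) (by omega) q hv)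

lemma exists_smul_mk_sub_killVars_sub_mem {σ : Type} [Finite σ] {I : Ideal (MvPolynomial σ k)}
    {A : Submodule (MvPolynomial σ k) (MvPolynomial σ k ⧸ I)} {U V : Set σ}
    (hext : LocallyExtends (maxIdeal k σ) (varIdeal k (U ∪ V)) A ⊤)
    (hUV : ∀ u ∈ U, ∀ v ∈ V, Ideal.Quotient.mk I (X u * X v) ∈
      localSaturation (maxIdeal k σ) A) :
    ∃ g ∉ maxIdeal k σ, ∃ s, ∀ w ∈ varIdeal k (U ∪ V),
      Ideal.Quotient.mk I (g * (w - killVars k U w) - w * s) ∈ A := by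
  obtain ⟨F, hF, hFA⟩ := exists_notMem_forall_smul_mem (maxIdeal k σ) A
  have hmul : varIdeal k U * varIdeal k V ≤
      Submodule.comap (Submodule.mkQ I) (localSaturation (maxIdeal k σ) A) := by
    rw [varIdeal, varIdeal, Ideal.span_mul_span', Ideal.span_le]
    rintro _ ⟨_, ⟨u, hu, rfl⟩, _, ⟨v, hv, rfl⟩, rfl⟩
    exact hUV u hu v hv
  have hkill : varIdeal k (U ∪ V) ≤ Ideal.comap (killVars k U) (varIdeal k V) :=
    varIdeal_le_iff.mpr fun v hv => by
      rw [Ideal.mem_comap]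
      by_cases hvU : v ∈ U
      · rw [killVars_X_of_mem hvU]
        exact zero_mem _
      · rw [killVars_X_of_notMem hvU]
        exact X_mem_varIdeal (hv.resolve_left hvU)
  obtain ⟨g, hg, u, -, hgu⟩ := hext
    (fun w => Ideal.Quotient.mk I (F * ((w : MvPolynomial σ k) - killVars k U w)))
    (fun _ => trivial) (fun w w' => by
      rw [← map_add, ← map_sub, Submodule.coe_add, map_add]
      convert zero_mem A using 1
      convert map_zero (Ideal.Quotient.mk I) using 2
      ring) fun s w => by
      convert hFA _ (hmul (Ideal.mul_mem_mul (sub_killVars_mem U s) (hkill w.2))) using 1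
      rw [Submodule.coe_smul, smul_eq_mul, map_mul (killVars k U)]
      change Ideal.Quotient.mk I _ - Ideal.Quotient.mk I (s * _) = Ideal.Quotient.mk I (F * _)
      rw [← map_sub]
      congr 1
      ring
  obtain ⟨s, rfl⟩ := Ideal.Quotient.mk_surjective u
  refine ⟨g * F, Ideal.IsPrime.mul_notMem inferInstance hg hF, s, fun w hw => ?_⟩
  convert hgu ⟨w, hw⟩ using 1
  change _ = Ideal.Quotient.mk I (g * _) - Ideal.Quotient.mk I (w * s)
  rw [← map_sub, mul_assoc]

end NotSequentiallyCohenMacaulay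

/-- If the partition `λ` is not saturated, then the Ferrers ideal `I_λ`
is not sequentially Cohen-Macaulay. -/
theorem stmt_9 (k : Type) [Field k] (n : ℕ) (lam : ℕ → ℕ)
    (hpart : IsPartitionFn n lam) (hnotsat : ¬ IsSaturated n lam) :
    ¬ IsSCMIdeal k (Fin n ⊕ Fin (lam 0)) (skewIdeal k n lam fun _ => 0) := by
  intro hSCM
  obtain ⟨a, e, hae, ha, he, hstep⟩ := exists_repeat_and_gap_of_not_isSaturated hpart hnotsat
  obtain ⟨-, hanti, -, hzero⟩ := hpart
  have hen : e < n := by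
    by_contra! h
    rw [hzero e h] at he
    omega
  have hdrop : ∀ c, a < c → c ≤ e → lam c + c = lam a + a + 1 := by
    intro c hac
    induction c, (hac : a + 1 ≤ c) using Nat.le_induction with
    | base => intro _; change lam (a + 1) + (a + 1) = _; omega
    | succ c hc ih =>
      intro hce
      have h1 := ih (by omega)
      have h2 := hstep c (by omega) (by omega)
      omega
  have he' := hdrop e hae le_rfl
  have h0 : ∀ c, lam c ≤ lam 0 := fun c => hanti (Nat.zero_le c)
  have h0a := h0 a
  obtain ⟨A, hfree, hext, hlow⟩ := hSCM.exists_submodule (n - a + (lam 0 - lam a))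
  have hsat := mk_X_mul_X_mem_localSaturation (k := k) (n := n) hanti (A := A) (a := a) (e := e)
    (fun c hac hce => hfree _ (by
      rw [ncard_compl_cornerVars]
      have h1 := hdrop (c + 1) (by omega) (by omega)
      have h2 := h0 (c + 1)
      omega)) hae
  have hunion : cornerVars n (lam 0) (e + 1) 0 ∪ cornerVars n (lam 0) 0 (lam a) =
      cornerVars n (lam 0) (e + 1) (lam a) := by
    ext v
    rcases v with i | j <;> simp [cornerVars]
  obtain ⟨g, hg, s, hs⟩ := exists_smul_mk_sub_killVars_sub_mem
    (U := cornerVars n (lam 0) (e + 1) 0) (V := cornerVars n (lam 0) 0 (lam a))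
    (hext _ (by
      rw [hunion, ncard_compl_cornerVars]
      omega)) (by
      rintro (i | j) hu (p | q) hv
      · exact absurd hv (Nat.not_lt_zero _)
      · exact hsat i (Nat.lt_succ_iff.mp hu) q (ha ▸ hv)
      · exact absurd hu (Nat.not_lt_zero _)
      · exact absurd hu (Nat.not_lt_zero _))
  rw [hunion] at hs
  have hs₁ : s ∈ maxIdeal k (Fin n ⊕ Fin (lam 0)) := by
    let y : Fin n ⊕ Fin (lam 0) := Sum.inr ⟨lam a - 1, by have := hanti hae.le; omega⟩
    have hmem := hlow (cornerVars n (lam 0) (e + 1) (lam (e + 1)))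
      (skewIdeal_le_varIdeal hanti (e + 1)) (by
        rw [ncard_compl_cornerVars]
        have := h0 (e + 1)
        omega) _ (hs (X y) (X_mem_varIdeal (inr_mem_cornerVars.mpr (by
        have := hanti hae.le
        simp only
        omega))))
    rw [killVars_X_of_notMem (show y ∉ _ from Nat.not_lt_zero _), sub_self, mul_zero, zero_sub,
      neg_mem_iff] at hmem
    refine varIdeal_le_maxIdeal _ (((varIdeal_isPrime _).mem_or_mem hmem).resolve_left
      (X_notMem_varIdeal fun h => ?_))
    have h1 : lam a - 1 < lam (e + 1) := h
    have := hanti hae.le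
    omega
  have hs₂ : g - s ∈ maxIdeal k (Fin n ⊕ Fin (lam 0)) := by
    let x : Fin n ⊕ Fin (lam 0) := Sum.inl ⟨a, hae.trans hen⟩
    have hx : x ∈ cornerVars n (lam 0) (e + 1) 0 := show a < e + 1 by omega
    have hmem := hlow (cornerVars n (lam 0) a (lam a)) (skewIdeal_le_varIdeal hanti a)
      (ncard_compl_cornerVars n (lam 0) a (lam a)).ge _ (hs (X x) (X_mem_varIdeal hx))
    rw [killVars_X_of_mem hx, sub_zero, mul_comm g, ← mul_sub] at hmem
    exact varIdeal_le_maxIdeal _ (((varIdeal_isPrime _).mem_or_mem hmem).resolve_left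
      (X_notMem_varIdeal fun h => lt_irrefl a h))
  exact hg ((sub_add_cancel g s) ▸ add_mem hs₂ hs₁)

end SkewTab
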